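/- arXiv:1608.04392 — 5 statements merged into one kernel-verified Lean document; each statement's English description precedes it below -/
import Mathlib

section
/- Let B = {(f1,f2) in R x R : (y+x) divides f1 - f2 and (y-x) divides f1 - f2}, a Q-subalgebra of R x R, and let A be the set of pairs (f1 + g1*eps, f2 + g2*eps) in DualNumber R x DualNumber R such that (y+x) and (y-x) both divide f1 - f2 and both divide g1 - g2, and x*y divides g1 and x*y divides g2. Then A is a Q-subalgebra of DualNumber R x DualNumber R, and the map from DualNumber B to DualNumber R x DualNumber R sending (f1,f2) + (h1,h2)*eps to (f1 + x*y*h1*eps, f2 + x*y*h2*eps) is an injective Q-algebra homomorphism whose image is exactly A; in particular A is isomorphic to DualNumber B as Q-algebras. -/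
open MvPolynomial TrivSqZeroExt

set_option synthInstance.maxHeartbeats 1000000
set_option maxHeartbeats 1000000

abbrev R2 : Type := MvPolynomial (Fin 2) ℚ

noncomputable abbrev x : R2 := X 0
noncomputable abbrev y : R2 := X 1

/-- A prime that does not divide `d` can be cancelled from a multiple of `d`. -/
theorem Prime.dvd_of_dvd_mul_left_of_not_dvd {S : Type*} [CommRing S] [IsDomain S] {p d k : S}
    (hp : Prime p) (hpd : ¬ p ∣ d) (h : d ∣ p * k) : d ∣ k := by
  obtain ⟨c, hc⟩ := h
  obtain ⟨c', rfl⟩ := (hp.dvd_or_dvd (Dvd.intro k hc)).resolve_left hpd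
  exact ⟨c', mul_left_cancel₀ hp.ne_zero (by rw [hc]; ring)⟩

theorem not_x_dvd_y : ¬ x ∣ y := by
  simp [x, y, X_dvd_X]

theorem not_y_dvd_x : ¬ y ∣ x := by
  simp [x, y, X_dvd_X]

theorem dvd_of_dvd_x_mul_y_mul {d k : R2} (hx : ¬ x ∣ d) (hy : ¬ y ∣ d)
    (h : d ∣ x * y * k) : d ∣ k := by
  rw [mul_assoc] at h
  exact (X_prime (i := 1)).dvd_of_dvd_mul_left_of_not_dvd hy
    ((X_prime (i := 0)).dvd_of_dvd_mul_left_of_not_dvd hx h)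

theorem dvd_of_y_add_x_dvd {k : R2} (h : y + x ∣ x * y * k) : y + x ∣ k :=
  dvd_of_dvd_x_mul_y_mul (fun hd => not_x_dvd_y ((dvd_add_left dvd_rfl).1 hd))
    (fun hd => not_y_dvd_x ((dvd_add_right dvd_rfl).1 hd)) h

theorem dvd_of_y_sub_x_dvd {k : R2} (h : y - x ∣ x * y * k) : y - x ∣ k :=
  dvd_of_dvd_x_mul_y_mul (fun hd => not_x_dvd_y ((dvd_sub_left dvd_rfl).1 hd))
    (fun hd => not_y_dvd_x ((dvd_sub_right dvd_rfl).1 hd)) h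

/-- The pairs of elements of `S` that are congruent modulo `d`. -/
def congruentPairs (k : Type*) {S : Type*} [CommRing k] [CommRing S] [Algebra k S] (d : S) :
    Subalgebra k (S × S) where
  carrier := {p | d ∣ p.1 - p.2}
  mul_mem' {p q} hp hq := by
    have h : (p * q).1 - (p * q).2 = (p.1 - p.2) * q.1 + p.2 * (q.1 - q.2) := by
      simp only [Prod.fst_mul, Prod.snd_mul]; ring
    simp only [Set.mem_ofPred_eq] at hp hq ⊢
    rw [h]
    exact dvd_add (hp.mul_right _) (hq.mul_left _)
  add_mem' {p q} hp hq := by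
    have h : (p + q).1 - (p + q).2 = (p.1 - p.2) + (q.1 - q.2) := by
      simp only [Prod.fst_add, Prod.snd_add]; ring
    simp only [Set.mem_ofPred_eq] at hp hq ⊢
    rw [h]
    exact dvd_add hp hq
  algebraMap_mem' r := by simp

/-- The algebra map `(f₁, f₂) + (h₁, h₂) ε ↦ (f₁ + c h₁ ε, f₂ + c h₂ ε)`. -/
noncomputable def scaleEps {k S : Type*} [CommRing k] [CommRing S] [Algebra k S]
    (B : Subalgebra k (S × S)) (c : S) : DualNumber B →ₐ[k] DualNumber S × DualNumber S :=
  DualNumber.lift ⟨((((inlAlgHom k S S).comp (AlgHom.fst k S S)).prod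
      ((inlAlgHom k S S).comp (AlgHom.snd k S S))).comp B.val, (inr c, inr c)),
    by ext <;> simp, fun _ => Commute.all _ _⟩

theorem scaleEps_apply {k S : Type*} [CommRing k] [CommRing S] [Algebra k S]
    (B : Subalgebra k (S × S)) (c : S) (p : DualNumber B) :
    scaleEps B c p = (inl (fst p).1.1 + inr (c * (snd p).1.1),
      inl (fst p).1.2 + inr (c * (snd p).1.2)) := by
  rw [scaleEps, DualNumber.lift_apply_apply]
  ext <;> simp [mul_comm]

theorem scaleEps_injective {k S : Type*} [CommRing k] [CommRing S] [IsDomain S] [Algebra k S]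
    (B : Subalgebra k (S × S)) {c : S} (hc : c ≠ 0) : Function.Injective (scaleEps B c) := by
  intro p q h
  simp only [scaleEps_apply, Prod.mk.injEq, TrivSqZeroExt.ext_iff, fst_add, snd_add, fst_inl,
    snd_inl, fst_inr, snd_inr, add_zero, zero_add, mul_right_inj' hc] at h
  exact TrivSqZeroExt.ext (Subtype.ext (Prod.ext h.1.1 h.2.1))
    (Subtype.ext (Prod.ext h.1.2 h.2.2))

theorem stmt_2 :
    ∃ (B : Subalgebra ℚ (R2 × R2))
      (A : Subalgebra ℚ (DualNumber R2 × DualNumber R2)),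
      (B : Set (R2 × R2)) =
        {p : R2 × R2 | (y + x) ∣ p.1 - p.2 ∧ (y - x) ∣ p.1 - p.2} ∧
      (A : Set (DualNumber R2 × DualNumber R2)) =
        {q : DualNumber R2 × DualNumber R2 |
          (y + x) ∣ fst q.1 - fst q.2 ∧ (y - x) ∣ fst q.1 - fst q.2 ∧
          (y + x) ∣ snd q.1 - snd q.2 ∧ (y - x) ∣ snd q.1 - snd q.2 ∧
          x * y ∣ snd q.1 ∧ x * y ∣ snd q.2} ∧
      ∃ φ : DualNumber ↥B →ₐ[ℚ] DualNumber R2 × DualNumber R2,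
        (∀ p : DualNumber ↥B,
          fst (φ p).1 = (((fst p : ↥B) : R2 × R2)).1 ∧
          snd (φ p).1 = x * y * (((snd p : ↥B) : R2 × R2)).1 ∧
          fst (φ p).2 = (((fst p : ↥B) : R2 × R2)).2 ∧
          snd (φ p).2 = x * y * (((snd p : ↥B) : R2 × R2)).2) ∧
        Function.Injective φ ∧
        φ.range = A ∧
        Nonempty (DualNumber ↥B ≃ₐ[ℚ] ↥A) := by
  have hinj := scaleEps_injective (congruentPairs ℚ (y + x) ⊓ congruentPairs ℚ (y - x))
    (mul_ne_zero (X_ne_zero 0) (X_ne_zero 1) : x * y ≠ 0)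
  refine ⟨congruentPairs ℚ (y + x) ⊓ congruentPairs ℚ (y - x), (scaleEps _ (x * y)).range,
    rfl, ?_, scaleEps _ (x * y), fun p => by simp [scaleEps_apply], hinj, rfl,
    ⟨AlgEquiv.ofInjective _ hinj⟩⟩
  ext q
  constructor
  · rintro ⟨p, rfl⟩
    obtain ⟨hf₁, hf₂⟩ := (fst p).2
    obtain ⟨hh₁, hh₂⟩ := (snd p).2
    change scaleEps _ (x * y) p ∈ _
    simp only [scaleEps_apply, Set.mem_ofPred_eq, fst_add, snd_add, fst_inl, snd_inl, fst_inr,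
      snd_inr, add_zero, zero_add, ← mul_sub]
    exact ⟨hf₁, hf₂, hh₁.mul_left _, hh₂.mul_left _, dvd_mul_right _ _, dvd_mul_right _ _⟩
  · rintro ⟨hf₁, hf₂, hg₁, hg₂, ⟨h₁, e₁⟩, ⟨h₂, e₂⟩⟩
    rw [e₁, e₂, ← mul_sub] at hg₁ hg₂
    refine ⟨inl ⟨(fst q.1, fst q.2), hf₁, hf₂⟩ +
      inr ⟨(h₁, h₂), dvd_of_y_add_x_dvd hg₁, dvd_of_y_sub_x_dvd hg₂⟩, ?_⟩
    change scaleEps _ (x * y) _ = q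
    rw [scaleEps_apply]
    ext <;> simp [e₁, e₂]
end

section
/- The set A of pairs (f1 + g1*eps, f2 + g2*eps) in DualNumber R x DualNumber R such that (y+x) and (y-x) both divide f1 - f2 and both divide g1 - g2, and x*y divides g1 and x*y divides g2, is an R-submodule of DualNumber R x DualNumber R which is a free R-module of rank 4. -/
open MvPolynomial TrivSqZeroExt

theorem isRelPrime_x_y : IsRelPrime x y := by
  have hx : Irreducible x := (X_prime (R := ℚ) (i := (0 : Fin 2))).irreducible
  refine hx.isRelPrime_iff_not_dvd.2 fun h => ?_
  simp [x, y, X_dvd_X] at h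

theorem isRelPrime_add_sub : IsRelPrime (y + x) (y - x) := by
  have half : (C (1 / 2) : R2) * 2 = 1 := by
    rw [← map_ofNat (C : ℚ →+* R2) 2, ← C_mul]
    norm_num
  intro d hadd hsub
  refine isRelPrime_x_y ?_ ?_
  · have h := (dvd_sub hadd hsub).mul_left (C (1 / 2))
    rwa [show C (1 / 2) * (y + x - (y - x)) = x by linear_combination x * half] at h
  · have h := (dvd_add hadd hsub).mul_left (C (1 / 2))
    rwa [show C (1 / 2) * (y + x + (y - x)) = y by linear_combination y * half] at h

theorem isRelPrime_add_mul : IsRelPrime (y + x) (x * y) := by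
  refine IsRelPrime.mul_right (fun d h hx => ?_) (fun d h hy => ?_)
  · exact isRelPrime_x_y hx (by simpa using dvd_sub h hx)
  · exact isRelPrime_x_y (by simpa using dvd_sub h hy) hy

theorem isRelPrime_sub_mul : IsRelPrime (y - x) (x * y) := by
  refine IsRelPrime.mul_right (fun d h hx => ?_) (fun d h hy => ?_)
  · exact isRelPrime_x_y hx (by simpa using dvd_add h hx)
  · exact isRelPrime_x_y (by simpa using dvd_sub hy h) hy

/-- The parametrization of the congruence module by its basis
`(1, 1)`, `(0, y² - x²)`, `(xyε, xyε)`, `(0, xy(y² - x²)ε)`. -/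
noncomputable def congruenceMap : (Fin 4 → R2) →ₗ[R2] DualNumber R2 × DualNumber R2 where
  toFun v :=
    (inl (v 0) + inr (x * y * v 2),
      inl (v 0 + (y + x) * (y - x) * v 1) +
        inr (x * y * v 2 + x * y * ((y + x) * (y - x)) * v 3))
  map_add' v w := by
    refine Prod.ext (TrivSqZeroExt.ext ?_ ?_) (TrivSqZeroExt.ext ?_ ?_) <;> simp <;> ring
  map_smul' r v := by
    refine Prod.ext (TrivSqZeroExt.ext ?_ ?_) (TrivSqZeroExt.ext ?_ ?_) <;> simp <;> ring

theorem add_mul_sub_ne_zero : (y + x) * (y - x) ≠ 0 := by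
  intro h
  have := congrArg (eval ![0, 1]) h
  simp at this

theorem congruenceMap_injective : Function.Injective congruenceMap := by
  have hxy : x * y ≠ 0 := mul_ne_zero (X_ne_zero _) (X_ne_zero _)
  refine (injective_iff_map_eq_zero _).2 fun v hv => ?_
  have h0 : v 0 = 0 := by simpa [congruenceMap] using congrArg (fun q => fst q.1) hv
  have h2 : x * y * v 2 = 0 := by simpa [congruenceMap] using congrArg (fun q => snd q.1) hv
  have h1 : v 0 + (y + x) * (y - x) * v 1 = 0 := by
    simpa only [congruenceMap, LinearMap.coe_mk, AddHom.coe_mk, fst_add, fst_inl, fst_inr,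
      add_zero, Prod.snd_zero, fst_zero] using congrArg (fun q => fst q.2) hv
  have h3 : x * y * v 2 + x * y * ((y + x) * (y - x)) * v 3 = 0 := by
    simpa only [congruenceMap, LinearMap.coe_mk, AddHom.coe_mk, snd_add, snd_inl, snd_inr,
      zero_add, Prod.snd_zero, snd_zero] using congrArg (fun q => snd q.2) hv
  rw [h0, zero_add] at h1
  rw [h2, zero_add] at h3
  funext i
  fin_cases i
  · exact h0
  · exact (mul_eq_zero.1 h1).resolve_left add_mul_sub_ne_zero
  · exact (mul_eq_zero.1 h2).resolve_left hxy
  · exact (mul_eq_zero.1 h3).resolve_left (mul_ne_zero hxy add_mul_sub_ne_zero)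

theorem coe_range_congruenceMap :
    (LinearMap.range congruenceMap : Set (DualNumber R2 × DualNumber R2)) =
      {q : DualNumber R2 × DualNumber R2 |
        (y + x) ∣ fst q.1 - fst q.2 ∧ (y - x) ∣ fst q.1 - fst q.2 ∧
        (y + x) ∣ snd q.1 - snd q.2 ∧ (y - x) ∣ snd q.1 - snd q.2 ∧
        x * y ∣ snd q.1 ∧ x * y ∣ snd q.2} := by
  ext q
  constructor
  · rintro ⟨v, rfl⟩
    simp only [congruenceMap, LinearMap.coe_mk, AddHom.coe_mk, Set.mem_ofPred_eq, fst_add,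
      fst_inl, fst_inr, snd_add, snd_inl, snd_inr, add_zero, zero_add]
    refine ⟨⟨-((y - x) * v 1), by ring⟩, ⟨-((y + x) * v 1), by ring⟩,
      ⟨-(x * y * (y - x) * v 3), by ring⟩, ⟨-(x * y * (y + x) * v 3), by ring⟩,
      ⟨v 2, rfl⟩, ⟨v 2 + (y + x) * (y - x) * v 3, by ring⟩⟩
  · rintro ⟨hf, hf', hg, hg', ⟨a, ha⟩, ⟨b, hb⟩⟩
    obtain ⟨c, hc⟩ := isRelPrime_add_sub.mul_dvd hf hf'
    rw [ha, hb, ← mul_sub] at hg hg'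
    obtain ⟨d, hd⟩ := isRelPrime_add_sub.mul_dvd (isRelPrime_add_mul.dvd_of_dvd_mul_left hg)
      (isRelPrime_sub_mul.dvd_of_dvd_mul_left hg')
    refine ⟨![fst q.1, -c, a, -d], ?_⟩
    refine Prod.ext (TrivSqZeroExt.ext ?_ ?_) (TrivSqZeroExt.ext ?_ ?_)
    · simp [congruenceMap]
    · simp [congruenceMap, ha]
    · simp only [congruenceMap, LinearMap.coe_mk, AddHom.coe_mk, fst_add, fst_inl, fst_inr,
        Matrix.cons_val]
      linear_combination hc
    · simp only [congruenceMap, LinearMap.coe_mk, AddHom.coe_mk, snd_add, snd_inl, snd_inr,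
        Matrix.cons_val]
      linear_combination x * y * hd - hb

theorem stmt_4 :
    ∃ A : Submodule R2 (DualNumber R2 × DualNumber R2),
      (A : Set (DualNumber R2 × DualNumber R2)) =
        {q : DualNumber R2 × DualNumber R2 |
          (y + x) ∣ fst q.1 - fst q.2 ∧ (y - x) ∣ fst q.1 - fst q.2 ∧
          (y + x) ∣ snd q.1 - snd q.2 ∧ (y - x) ∣ snd q.1 - snd q.2 ∧
          x * y ∣ snd q.1 ∧ x * y ∣ snd q.2} ∧
      Module.Free R2 ↥A ∧ Module.rank R2 ↥A = 4 := by
  let e := LinearEquiv.ofInjective congruenceMap congruenceMap_injective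
  refine ⟨LinearMap.range congruenceMap, coe_range_congruenceMap, Module.Free.of_equiv e, ?_⟩
  rw [← e.rank_eq, rank_fin_fun]
  rfl
end

section
/- Let n be a natural number, R = MvPolynomial (Fin n) Q, let alpha be a nonzero element of R, and let f >= 1 be a natural number. The set of pairs of tuples ((P_1,...,P_f),(Q_1,...,Q_f)) in R^f x R^f such that alpha divides P_i - P_j for all i, j and alpha divides the sum Q_1 + ... + Q_f, is an R-submodule of R^f x R^f which is a free R-module of rank 2f. -/
section CongruenceModules

variable {R : Type*} [CommRing R] {g : ℕ}

/-- The linear map `p ↦ (p₀, p₀ + α p₁, …, p₀ + α p_g)`, which parametrizes the tuples whose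
entries are all congruent modulo `α`. -/
def congruentTuples (α : R) : (Fin (g + 1) → R) →ₗ[R] (Fin (g + 1) → R) where
  toFun p := Fin.cons (p 0) fun i => p 0 + α * p i.succ
  map_add' p q := by
    ext i
    refine Fin.cases ?_ (fun i => ?_) i <;> simp
    ring
  map_smul' c p := by
    ext i
    refine Fin.cases ?_ (fun i => ?_) i <;> simp
    ring

/-- The linear map `q ↦ (α q₀ - (q₁ + ⋯ + q_g), q₁, …, q_g)`, which parametrizes the tuples whose
sum is divisible by `α`. -/
def tuplesOfDvdSum (α : R) : (Fin (g + 1) → R) →ₗ[R] (Fin (g + 1) → R) where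
  toFun q := Fin.cons (α * q 0 - ∑ i : Fin g, q i.succ) fun i => q i.succ
  map_add' p q := by
    ext i
    refine Fin.cases ?_ (fun i => ?_) i <;> simp [Finset.sum_add_distrib]
    ring
  map_smul' c p := by
    ext i
    refine Fin.cases ?_ (fun i => ?_) i <;> simp [← Finset.mul_sum]
    ring

theorem mem_range_congruentTuples {α : R} {p : Fin (g + 1) → R} :
    p ∈ LinearMap.range (congruentTuples α) ↔ ∀ i j, α ∣ p i - p j := by
  constructor
  · rintro ⟨p, rfl⟩
    have key : ∀ i, α ∣ congruentTuples α p i - p 0 := by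
      refine Fin.cases ?_ fun i => ?_ <;> simp [congruentTuples]
    intro i j
    simpa using dvd_sub (key i) (key j)
  · intro h
    choose c hc using fun i : Fin g => h i.succ 0
    refine ⟨Fin.cons (p 0) c, ?_⟩
    ext i
    refine Fin.cases ?_ (fun i => ?_) i <;> simp [congruentTuples, ← hc]

theorem mem_range_tuplesOfDvdSum {α : R} {q : Fin (g + 1) → R} :
    q ∈ LinearMap.range (tuplesOfDvdSum α) ↔ α ∣ ∑ i, q i := by
  constructor
  · rintro ⟨q, rfl⟩
    simp [tuplesOfDvdSum, Fin.sum_univ_succ]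
  · rintro ⟨c, hc⟩
    refine ⟨Fin.cons c fun i => q i.succ, ?_⟩
    ext i
    refine Fin.cases ?_ (fun i => ?_) i <;> simp [tuplesOfDvdSum, ← hc, Fin.sum_univ_succ]

variable [IsDomain R]

theorem congruentTuples_injective {α : R} (hα : α ≠ 0) :
    Function.Injective (congruentTuples (g := g) α) := by
  intro p q h
  have h0 : p 0 = q 0 := by simpa [congruentTuples] using congrFun h 0
  ext i
  refine Fin.cases h0 (fun i => ?_) i
  simpa [congruentTuples, h0, hα] using congrFun h i.succ

theorem tuplesOfDvdSum_injective {α : R} (hα : α ≠ 0) :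
    Function.Injective (tuplesOfDvdSum (g := g) α) := by
  intro p q h
  have hs (i : Fin g) : p i.succ = q i.succ := by
    simpa [tuplesOfDvdSum] using congrFun h i.succ
  ext i
  refine Fin.cases ?_ hs i
  simpa [tuplesOfDvdSum, hs, hα] using congrFun h 0

end CongruenceModules

theorem stmt_15 (n : ℕ) (α : MvPolynomial (Fin n) ℚ) (hα : α ≠ 0)
    (f : ℕ) (hf : 1 ≤ f) :
    ∃ M : Submodule (MvPolynomial (Fin n) ℚ)
        ((Fin f → MvPolynomial (Fin n) ℚ) × (Fin f → MvPolynomial (Fin n) ℚ)),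
      (M : Set ((Fin f → MvPolynomial (Fin n) ℚ) × (Fin f → MvPolynomial (Fin n) ℚ))) =
        {PQ | (∀ i j : Fin f, α ∣ PQ.1 i - PQ.1 j) ∧ α ∣ ∑ i : Fin f, PQ.2 i} ∧
      Module.Free (MvPolynomial (Fin n) ℚ) ↥M ∧
      Module.rank (MvPolynomial (Fin n) ℚ) ↥M = 2 * f := by
  obtain ⟨g, rfl⟩ := Nat.exists_eq_add_of_le' hf
  let φ := (congruentTuples (g := g) α).prodMap (tuplesOfDvdSum (g := g) α)
  have hφ : Function.Injective φ :=
    (congruentTuples_injective hα).prodMap (tuplesOfDvdSum_injective hα)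
  let e := LinearEquiv.ofInjective φ hφ
  refine ⟨LinearMap.range φ, ?_, Module.Free.of_equiv e, ?_⟩
  · ext PQ
    simp only [φ, LinearMap.range_prodMap, SetLike.mem_coe, Submodule.mem_prod,
      mem_range_congruentTuples, mem_range_tuplesOfDvdSum, Set.mem_ofPred_eq]
  · rw [← e.rank_eq, rank_prod', rank_fin_fun, two_mul]
end

section
/- Let n be a natural number, R = MvPolynomial (Fin n) Q, let alpha be a nonzero element of R, and let f >= 1 be a natural number. The set of pairs of tuples ((P_1,...,P_f),(Q_1,...,Q_f)) in R^f x R^f such that alpha divides P_i - P_j for all i, j, is an R-submodule of R^f x R^f which is a free R-module of rank 2f. -/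
section CongruentTuples

variable {R ι : Type*} [CommRing R] [DecidableEq ι]

/-- The endomorphism of `ι → R` sending `p` to the tuple with value `p i₀` at `i₀` and
`p i₀ + a * p i` at every other index `i`. -/
def congruentTupleMap (a : R) (i₀ : ι) : (ι → R) →ₗ[R] (ι → R) where
  toFun p i := p i₀ + if i = i₀ then 0 else a * p i
  map_add' p q := by
    ext i
    by_cases h : i = i₀ <;> simp [h] <;> ring
  map_smul' c p := by
    ext i
    by_cases h : i = i₀ <;> simp [h] <;> ring

theorem congruentTupleMap_apply (a : R) (i₀ : ι) (p : ι → R) (i : ι) :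
    congruentTupleMap a i₀ p i = p i₀ + if i = i₀ then 0 else a * p i := rfl

theorem congruentTupleMap_injective [IsDomain R] {a : R} (ha : a ≠ 0) (i₀ : ι) :
    Function.Injective (congruentTupleMap a i₀) := by
  intro p q h
  have h₀ : p i₀ = q i₀ := by
    simpa [congruentTupleMap_apply] using congrFun h i₀
  ext i
  by_cases hi : i = i₀
  · rw [hi, h₀]
  · simpa [congruentTupleMap_apply, hi, h₀, ha] using congrFun h i

theorem mem_range_congruentTupleMap {a : R} {i₀ : ι} {p : ι → R} :
    p ∈ LinearMap.range (congruentTupleMap a i₀) ↔ ∀ i j, a ∣ p i - p j := by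
  constructor
  · rintro ⟨q, rfl⟩ i j
    have key (k : ι) : a ∣ if k = i₀ then 0 else a * q k := by
      split_ifs <;> simp
    simpa [congruentTupleMap_apply] using dvd_sub (key i) (key j)
  · intro h
    choose c hc using fun i => h i i₀
    refine ⟨fun i => if i = i₀ then p i₀ else c i, ?_⟩
    ext i
    by_cases hi : i = i₀
    · simp [congruentTupleMap_apply, hi]
    · simp [congruentTupleMap_apply, hi, ← hc]

end CongruentTuples

theorem stmt_16 (n : ℕ) (α : MvPolynomial (Fin n) ℚ) (hα : α ≠ 0)
    (f : ℕ) (hf : 1 ≤ f) :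
    ∃ M : Submodule (MvPolynomial (Fin n) ℚ)
        ((Fin f → MvPolynomial (Fin n) ℚ) × (Fin f → MvPolynomial (Fin n) ℚ)),
      (M : Set ((Fin f → MvPolynomial (Fin n) ℚ) × (Fin f → MvPolynomial (Fin n) ℚ))) =
        {PQ | ∀ i j : Fin f, α ∣ PQ.1 i - PQ.1 j} ∧
      Module.Free (MvPolynomial (Fin n) ℚ) ↥M ∧
      Module.rank (MvPolynomial (Fin n) ℚ) ↥M = 2 * f := by
  let φ := (congruentTupleMap α (⟨0, hf⟩ : Fin f)).prodMap
    (LinearMap.id : (Fin f → MvPolynomial (Fin n) ℚ) →ₗ[MvPolynomial (Fin n) ℚ] _)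
  have hφ : Function.Injective φ :=
    (congruentTupleMap_injective hα _).prodMap Function.injective_id
  let e := LinearEquiv.ofInjective φ hφ
  refine ⟨LinearMap.range φ, ?_, Module.Free.of_equiv e, ?_⟩
  · ext PQ
    rw [SetLike.mem_coe, LinearMap.range_prodMap, Submodule.mem_prod,
      mem_range_congruentTupleMap]
    simp
  · rw [← e.rank_eq]
    simp [two_mul]
end

section
/- Let R be a commutative ring, V and I types, e0, e1 : I -> V two maps, and w : I -> R a weight function. Let B = {f : V -> R | for all i, w i divides f (e0 i) - f (e1 i)}, a subalgebra of the product algebra V -> R, and let A~ = {F : V -> DualNumber R | for all i, w i divides the first component of F (e0 i) - F (e1 i) and w i divides the second (eps) component of F (e0 i) - F (e1 i)}. Then A~ is a subalgebra of V -> DualNumber R, and the map from DualNumber B to (V -> DualNumber R) sending f + h*eps (with f, h in B) to the function v |-> f v + (h v)*eps is an injective R-algebra homomorphism whose image is exactly A~; in particular A~ is isomorphic to DualNumber B as R-algebras. -/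
open TrivSqZeroExt

set_option synthInstance.maxHeartbeats 1000000
set_option maxHeartbeats 1000000

/-- The functions on the vertices satisfying the congruence `w i ∣ f (e0 i) - f (e1 i)` along every
edge `i`. -/
def gkmSubalgebra {R V I : Type*} [CommRing R] (e0 e1 : I → V) (w : I → R) :
    Subalgebra R (V → R) where
  carrier := {f | ∀ i, w i ∣ f (e0 i) - f (e1 i)}
  mul_mem' {f g} hf hg i := by
    have h : (f * g) (e0 i) - (f * g) (e1 i) =
        (f (e0 i) - f (e1 i)) * g (e0 i) + f (e1 i) * (g (e0 i) - g (e1 i)) := by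
      simp only [Pi.mul_apply]; ring
    rw [h]
    exact dvd_add ((hf i).mul_right _) ((hg i).mul_left _)
  add_mem' {f g} hf hg i := by
    simpa only [Pi.add_apply, add_sub_add_comm] using dvd_add (hf i) (hg i)
  algebraMap_mem' r i := by simp

/-- The map sending a dual number `f + h ε` over an algebra `B` of functions to the function
`v ↦ f v + h v ε`. -/
def dualNumberToPi {R V : Type*} [CommRing R] (B : Subalgebra R (V → R)) :
    DualNumber B →ₐ[R] (V → DualNumber R) where
  toFun p v := inl (((fst p : B) : V → R) v) + inr (((snd p : B) : V → R) v)
  map_one' := by ext v <;> simp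
  map_zero' := by ext v <;> simp
  map_add' p q := by ext v <;> simp
  map_mul' p q := by ext v <;> simp
  commutes' r := by ext v <;> simp [TrivSqZeroExt.algebraMap_eq_inl']

section

variable {R V : Type*} [CommRing R] (B : Subalgebra R (V → R))

@[simp]
theorem fst_dualNumberToPi (p : DualNumber B) (v : V) :
    fst (dualNumberToPi B p v) = ((fst p : B) : V → R) v := by
  simp [dualNumberToPi]

@[simp]
theorem snd_dualNumberToPi (p : DualNumber B) (v : V) :
    snd (dualNumberToPi B p v) = ((snd p : B) : V → R) v := by
  simp [dualNumberToPi]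

theorem dualNumberToPi_injective : Function.Injective (dualNumberToPi B) := by
  intro p q h
  refine TrivSqZeroExt.ext (Subtype.ext (funext fun v => ?_)) (Subtype.ext (funext fun v => ?_))
  · simpa using congrArg fst (congrFun h v)
  · simpa using congrArg snd (congrFun h v)

theorem mem_range_dualNumberToPi {F : V → DualNumber R} :
    F ∈ (dualNumberToPi B).range ↔ (fun v => fst (F v)) ∈ B ∧ (fun v => snd (F v)) ∈ B := by
  constructor
  · rintro ⟨p, rfl⟩
    simp
  · rintro ⟨hf, hs⟩
    exact ⟨(⟨_, hf⟩, ⟨_, hs⟩), funext fun v =>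
      TrivSqZeroExt.ext (fst_dualNumberToPi B _ v) (snd_dualNumberToPi B _ v)⟩

end

theorem stmt_17 (R : Type*) [CommRing R] (V I : Type*)
    (e0 e1 : I → V) (w : I → R) :
    ∃ (B : Subalgebra R (V → R)) (A : Subalgebra R (V → DualNumber R)),
      (B : Set (V → R)) = {f | ∀ i, w i ∣ f (e0 i) - f (e1 i)} ∧
      (A : Set (V → DualNumber R)) =
        {F | ∀ i, w i ∣ fst (F (e0 i) - F (e1 i)) ∧ w i ∣ snd (F (e0 i) - F (e1 i))} ∧
      ∃ φ : DualNumber ↥B →ₐ[R] (V → DualNumber R),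
        (∀ (p : DualNumber ↥B) (v : V),
          fst (φ p v) = ((fst p : ↥B) : V → R) v ∧
          snd (φ p v) = ((snd p : ↥B) : V → R) v) ∧
        Function.Injective φ ∧
        φ.range = A ∧
        Nonempty (DualNumber ↥B ≃ₐ[R] ↥A) := by
  refine ⟨gkmSubalgebra e0 e1 w, (dualNumberToPi (gkmSubalgebra e0 e1 w)).range, rfl, ?_,
    dualNumberToPi _, fun p v => ⟨fst_dualNumberToPi _ p v, snd_dualNumberToPi _ p v⟩,
    dualNumberToPi_injective _, rfl, ⟨AlgEquiv.ofInjective _ (dualNumberToPi_injective _)⟩⟩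
  ext F
  rw [SetLike.mem_coe, mem_range_dualNumberToPi]
  exact forall_and.symm
end
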